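/- arXiv:1602.06173 — 2 statements merged into one kernel-verified Lean document; each statement's English description precedes it below -/
import Mathlib

section
/- Let n ≥ 1 and q ∈ (q_{n−1}, q_n]. For 1 ≤ j ≤ n let w_j denote the word (τ_1⋯τ_{2^{j−1}})^−, i.e., the word τ_1⋯τ_{2^{j−1}} with its last digit decreased by 1 (so w_1 = 0). Then for every 1 ≤ j ≤ n and all nonnegative integers m_1, …, m_{j−1}, the infinite sequence w_1^{m_1} w_2^{m_2} ⋯ w_{j−1}^{m_{j−1}} w_j^∞ (the concatenation of m_1 copies of w_1, then m_2 copies of w_2, …, followed by the periodic repetition of w_j) belongs to U_q', and so does its reflection (obtained by replacing every digit d by 1 − d). -/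
open Filter Topology

noncomputable section

/-- The value `Σ_{i≥0} d i / q^(i+1)` of a (0-indexed) digit sequence `d` in base `q`;
this corresponds to `((d_i)_{i≥1})_q` with `d_i = d (i-1)`. -/
def seqVal (q : ℝ) (d : ℕ → ℕ) : ℝ := ∑' i : ℕ, (d i : ℝ) / q ^ (i + 1)

/-- `d` is a `q`-expansion of `x` with digits in `{0,1}`. -/
def IsExpansion (q x : ℝ) (d : ℕ → ℕ) : Prop :=
  (∀ i, d i ≤ 1) ∧ x = seqVal q d

/-- `x` has a unique `q`-expansion. -/
def HasUniqueExpansion (q x : ℝ) : Prop := ∃! d : ℕ → ℕ, IsExpansion q x d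

/-- The set `U(x)` of univoque bases of `x`. -/
def UBases (x : ℝ) : Set ℝ := {q | 1 < q ∧ q < 2 ∧ HasUniqueExpansion q x}

/-- `q_s(x) = inf U(x)`. -/
def qs (x : ℝ) : ℝ := sInf (UBases x)

/-- The univoque set `U_q` of `x ∈ [0, 1/(q-1)]` with a unique `q`-expansion. -/
def Uset (q : ℝ) : Set ℝ :=
  {x | x ∈ Set.Icc 0 (1 / (q - 1)) ∧ HasUniqueExpansion q x}

/-- The set `U_q'` of digit sequences which are the unique `q`-expansion of their value. -/
def USeq (q : ℝ) : Set (ℕ → ℕ) :=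
  {d | (∀ i, d i ≤ 1) ∧ ∀ e : ℕ → ℕ, IsExpansion q (seqVal q d) e → e = d}

/-- The Thue–Morse sequence: `τ 0 = 0`, `τ (2n) = τ n`, `τ (2n+1) = 1 - τ n`. -/
def IsThueMorse (τ : ℕ → ℕ) : Prop :=
  τ 0 = 0 ∧ (∀ n, τ (2 * n) = τ n) ∧ ∀ n, τ (2 * n + 1) = 1 - τ n

/-- `q` is the Komornik–Loreti constant: the base in `(1,2)` with `1 = Σ_{i≥1} τ_i q^{-i}`. -/
def IsKL (τ : ℕ → ℕ) (q : ℝ) : Prop :=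
  1 < q ∧ q < 2 ∧ (1 : ℝ) = ∑' i : ℕ, (τ (i + 1) : ℝ) / q ^ (i + 1)

/-- `Q` is the sequence of bases `q_n`: `Q 0 = 1` and for `n ≥ 1`, `Q n` is the root in
`(1,2)` of `1 = Σ_{i=1}^{2^n} τ_i q^{-i}`. -/
def IsBaseSeq (τ : ℕ → ℕ) (Q : ℕ → ℝ) : Prop :=
  Q 0 = 1 ∧ ∀ n, 1 ≤ n → 1 < Q n ∧ Q n < 2 ∧
    (1 : ℝ) = ∑ i ∈ Finset.range (2 ^ n), (τ (i + 1) : ℝ) / (Q n) ^ (i + 1)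

/-- `D_n = ⋃_{q ∈ (q_{n-1}, q_n]} U_q`. -/
def D (Q : ℕ → ℝ) (n : ℕ) : Set ℝ := ⋃ q ∈ Set.Ioc (Q (n - 1)) (Q n), Uset q

/-- The golden ratio. -/
def qG : ℝ := (1 + Real.sqrt 5) / 2

/-- Strict lexicographical order on digit sequences. -/
def seqLt (c d : ℕ → ℕ) : Prop := ∃ n, (∀ i, i < n → c i = d i) ∧ c n < d n

/-- The word `τ_1 ⋯ τ_m`. -/
def tmPrefix (τ : ℕ → ℕ) (m : ℕ) : List ℕ := (List.range m).map fun i => τ (i + 1)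

/-- `w⁻`: decrease the last digit of a word by 1. -/
def lastDec (w : List ℕ) : List ℕ := w.dropLast ++ [w.getLastD 0 - 1]

/-- `w⁺`: increase the last digit of a word by 1. -/
def lastInc (w : List ℕ) : List ℕ := w.dropLast ++ [w.getLastD 0 + 1]

/-- The reflection of a word. -/
def reflect (w : List ℕ) : List ℕ := w.map fun d => 1 - d

/-- The infinite sequence given by the prefix `p` followed by periodic repetition of `w`. -/
def prefPeriodic (p w : List ℕ) : ℕ → ℕ := fun j =>
  if j < p.length then p.getD j 0 else w.getD ((j - p.length) % w.length) 0

/-- `z_n = ((τ_1⋯τ_{2^{n-1}})(τ_{2^{n-1}+1}⋯τ_{2^n})^∞)_{q_n}`. -/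
def zVal (τ : ℕ → ℕ) (Q : ℕ → ℝ) (n : ℕ) : ℝ :=
  seqVal (Q n) (prefPeriodic (tmPrefix τ (2 ^ (n - 1)))
    ((List.range (2 ^ (n - 1))).map fun i => τ (2 ^ (n - 1) + (i + 1))))

/-- `z_{1,k} = Σ_{i=1}^k q_G^{-i} + 1/(q_G^k (q_G^2 - 1))`. -/
def z1 (k : ℕ) : ℝ :=
  (∑ i ∈ Finset.range k, 1 / qG ^ (i + 1)) + 1 / (qG ^ k * (qG ^ 2 - 1))

/-- The sequence `w_1^{m_1} w_2^{m_2} ⋯ w_{j-1}^{m_{j-1}} w_j^∞`, where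
`w_i = (τ_1⋯τ_{2^{i-1}})⁻`. -/
def glendSeq (τ : ℕ → ℕ) (j : ℕ) (m : ℕ → ℕ) : ℕ → ℕ :=
  prefPeriodic
    (((List.range (j - 1)).map fun i =>
        (List.replicate (m (i + 1)) (lastDec (tmPrefix τ (2 ^ i)))).flatten).flatten)
    (lastDec (tmPrefix τ (2 ^ (j - 1))))

namespace GS

/-- tail -/
def tl (k : ℕ) (d : ℕ → ℕ) : ℕ → ℕ := fun i => d (i + k)
/-- reflection -/
def rf (d : ℕ → ℕ) : ℕ → ℕ := fun i => 1 - d i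
/-- cons -/
def cn (a : ℕ) (d : ℕ → ℕ) : ℕ → ℕ := fun i => if i = 0 then a else d (i - 1)
/-- substitution -/
def sg (x : ℕ → ℕ) : ℕ → ℕ := fun i => if i % 2 = 0 then x (i / 2) else 1 - x (i / 2)
/-- lexicographic order -/
def lexLe (e a : ℕ → ℕ) : Prop := e = a ∨ seqLt e a

lemma summ {q : ℝ} (hq : 1 < q) {d : ℕ → ℕ} (hd : ∀ i, d i ≤ 1) :
    Summable (fun i : ℕ => (d i : ℝ) / q ^ (i + 1)) := by
  have h1 : Summable (fun i : ℕ => (1 / q) ^ i) :=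
    summable_geometric_of_lt_one (by positivity) (by rw [div_lt_one (by linarith)]; exact hq)
  refine Summable.of_nonneg_of_le (fun i => by positivity) (fun i => ?_) h1
  have : (d i : ℝ) ≤ 1 := by exact_mod_cast hd i
  rw [div_pow, one_pow]
  have hp : 0 < q ^ i := by positivity
  gcongr
  · exact hq.le
  · omega

lemma val_split {q : ℝ} (hq : 1 < q) {d : ℕ → ℕ} (hd : ∀ i, d i ≤ 1) (k : ℕ) :
    seqVal q d = ∑ i ∈ Finset.range k, (d i : ℝ) / q ^ (i + 1) + seqVal q (tl k d) / q ^ k := by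
  unfold seqVal
  rw [← (summ hq hd).sum_add_tsum_nat_add k, ← tsum_div_const]
  congr 1
  refine tsum_congr fun i => ?_
  have : q ≠ 0 := by positivity
  simp only [tl]
  rw [div_div, ← pow_add]
  congr 2; omega

lemma val_nonneg {q : ℝ} (hq : 1 < q) (d : ℕ → ℕ) : 0 ≤ seqVal q d :=
  tsum_nonneg fun i => by positivity

lemma val_le {q : ℝ} (hq : 1 < q) {d : ℕ → ℕ} (hd : ∀ i, d i ≤ 1) :
    seqVal q d ≤ seqVal q (fun _ => 1) := by
  refine Summable.tsum_le_tsum (fun i => ?_) (summ hq hd) (summ hq (fun _ => le_rfl))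
  have : (d i : ℝ) ≤ 1 := by exact_mod_cast hd i
  push_cast
  gcongr

lemma val_rf {q : ℝ} (hq : 1 < q) {d : ℕ → ℕ} (hd : ∀ i, d i ≤ 1) :
    seqVal q (rf d) = seqVal q (fun _ => 1) - seqVal q d := by
  unfold seqVal
  rw [← (summ hq (fun _ => le_rfl)).tsum_sub (summ hq hd)]
  refine tsum_congr fun i => ?_
  simp only [rf]
  rw [Nat.cast_sub (hd i)]
  ring

lemma mem_USeq {q : ℝ} (hq : 1 < q) {d : ℕ → ℕ} (hd : ∀ i, d i ≤ 1)
    (h0 : ∀ k, d k = 0 → seqVal q (tl (k + 1) d) < 1)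
    (h1 : ∀ k, d k = 1 → seqVal q (rf (tl (k + 1) d)) < 1) : d ∈ USeq q := by
  refine ⟨hd, fun e he => ?_⟩
  obtain ⟨he1, hv⟩ := he
  by_contra hne
  have hex : ∃ k, e k ≠ d k := by
    by_contra hc
    push Not at hc
    exact hne (funext hc)
  classical
  set k := Nat.find hex with hk
  have hk1 : e k ≠ d k := Nat.find_spec hex
  have hk2 : ∀ i < k, e i = d i := fun i hi => by
    by_contra hc
    exact Nat.find_min hex hi hc
  rw [val_split hq hd (k + 1), val_split hq he1 (k + 1), Finset.sum_range_succ,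
    Finset.sum_range_succ] at hv
  have hs : ∑ i ∈ Finset.range k, (e i : ℝ) / q ^ (i + 1)
      = ∑ i ∈ Finset.range k, (d i : ℝ) / q ^ (i + 1) :=
    Finset.sum_congr rfl fun i hi => by rw [hk2 i (Finset.mem_range.1 hi)]
  rw [hs] at hv
  have hp : 0 < q ^ (k + 1) := by positivity
  have hv2 : (d k : ℝ) + seqVal q (tl (k + 1) d) = e k + seqVal q (tl (k + 1) e) := by
    have h3 : ((d k : ℝ) + seqVal q (tl (k + 1) d)) / q ^ (k + 1)
        = (e k + seqVal q (tl (k + 1) e)) / q ^ (k + 1) := by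
      rw [add_div, add_div]; linarith
    exact (div_left_inj' hp.ne').1 h3
  have := hd k
  have := he1 k
  rcases Nat.eq_zero_or_pos (d k) with h | h
  · have h2 : e k = 1 := by omega
    have h3 := h0 k h
    have h4 := val_nonneg hq (tl (k + 1) e)
    rw [h, h2] at hv2
    push_cast at hv2
    linarith
  · have h' : d k = 1 := by omega
    have h2 : e k = 0 := by omega
    have h3 := h1 k h'
    rw [val_rf hq (d := tl (k + 1) d) (fun i => hd _)] at h3
    have h4 := val_le hq (d := tl (k + 1) e) (fun i => he1 _)
    rw [h', h2] at hv2
    push_cast at hv2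
    linarith

/-- half goodness -/
def HG (a e : ℕ → ℕ) : Prop :=
  (∀ i, e i ≤ 1) ∧ lexLe e a ∧ ∀ k, e k = 0 → lexLe (tl (k + 1) e) a

lemma HG.tail {a e : ℕ → ℕ} (h : HG a e) {k : ℕ} (hk : e k = 0) : HG a (tl (k + 1) e) := by
  refine ⟨fun i => h.1 _, h.2.2 k hk, fun l hl => ?_⟩
  have := h.2.2 (l + (k + 1)) hl
  have e1 : tl (l + (k + 1) + 1) e = tl (l + 1) (tl (k + 1) e) := by
    funext i; simp only [tl]; congr 1; omega
  rwa [e1] at this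

/-- key one-step estimate -/
lemma HG.step {q : ℝ} (hq : 1 < q) {a : ℕ → ℕ} (ha : ∀ i, a i ≤ 1) {e : ℕ → ℕ} (h : HG a e)
    {B : ℝ} (hB : 0 ≤ B) (hS : ∀ e', HG a e' → seqVal q e' ≤ 1 + B) :
    seqVal q e ≤ seqVal q a + B / q := by
  have hBq : 0 ≤ B / q := by positivity
  rcases h.2.1 with he | ⟨k, hk1, hk2⟩
  · rw [he]; linarith
  have hak : a k = 1 := by have := ha k; omega
  have hek : e k = 0 := by omega
  have ht := hS _ (h.tail hek)
  rw [val_split hq h.1 (k + 1), val_split hq ha (k + 1), Finset.sum_range_succ,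
    Finset.sum_range_succ, hak, hek]
  have hs : ∑ i ∈ Finset.range k, (e i : ℝ) / q ^ (i + 1)
      = ∑ i ∈ Finset.range k, (a i : ℝ) / q ^ (i + 1) :=
    Finset.sum_congr rfl fun i hi => by rw [hk1 i (Finset.mem_range.1 hi)]
  rw [hs]
  have hp : 0 < q ^ (k + 1) := by positivity
  have h4 : 0 ≤ seqVal q (tl (k + 1) a) / q ^ (k + 1) :=
    div_nonneg (val_nonneg hq _) hp.le
  have h5 : seqVal q (tl (k + 1) e) / q ^ (k + 1) ≤ (1 + B) / q ^ (k + 1) := by gcongr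
  have h6 : B / q ^ (k + 1) ≤ B / q := by
    have : q ≤ q ^ (k + 1) := le_self_pow₀ hq.le (by omega)
    gcongr
  rw [add_div] at h5
  push_cast
  rw [zero_div]
  linarith

lemma HG.val_lt {q : ℝ} (hq : 1 < q) {a : ℕ → ℕ} (ha : ∀ i, a i ≤ 1) (hV : seqVal q a < 1)
    {e : ℕ → ℕ} (h : HG a e) : seqVal q e < 1 := by
  set C := seqVal q (fun _ => 1) with hC
  have hC0 : 0 ≤ C := val_nonneg hq _
  have key : ∀ m : ℕ, ∀ e, HG a e → seqVal q e ≤ 1 + C / q ^ m := by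
    intro m
    induction m with
    | zero => intro e he; have := val_le hq he.1; simp; linarith
    | succ m ih =>
      intro e he
      have := he.step hq ha (B := C / q ^ m) (by positivity) ih
      rw [div_div, ← pow_succ] at this
      linarith
  have h1 : ∀ e, HG a e → seqVal q e ≤ 1 + 0 := by
    intro e he
    have ht : Tendsto (fun m : ℕ => 1 + C / q ^ m) atTop (𝓝 (1 + 0)) :=
      Tendsto.const_add _ (Tendsto.const_div_atTop (tendsto_pow_atTop_atTop_of_one_lt hq) _)
    exact ge_of_tendsto' ht fun m => key m e he
  have := h.step hq ha le_rfl h1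
  simp at this
  linarith

/-- full goodness -/
def Good (a d : ℕ → ℕ) : Prop :=
  (∀ i, d i ≤ 1) ∧ lexLe d a ∧ (∀ k, d k = 0 → lexLe (tl (k + 1) d) a) ∧
    (∀ k, d k = 1 → lexLe (rf (tl (k + 1) d)) a)

lemma rf_rf {d : ℕ → ℕ} (hd : ∀ i, d i ≤ 1) : rf (rf d) = d := by
  funext i; have := hd i; simp only [rf]; omega

lemma Good.fin {q : ℝ} (hq : 1 < q) {a : ℕ → ℕ} (ha : ∀ i, a i ≤ 1) (hV : seqVal q a < 1)
    {d : ℕ → ℕ} (h : Good a d) : d ∈ USeq q ∧ rf d ∈ USeq q := by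
  have hr : ∀ i, rf d i ≤ 1 := fun i => by simp only [rf]; omega
  have h0 : ∀ k, d k = 0 → seqVal q (tl (k + 1) d) < 1 := fun k hk =>
    HG.val_lt hq ha hV (HG.tail ⟨h.1, h.2.1, h.2.2.1⟩ hk)
  have h1 : ∀ k, d k = 1 → seqVal q (rf (tl (k + 1) d)) < 1 := by
    intro k hk
    refine HG.val_lt hq ha hV ⟨fun i => by simp only [rf]; omega, h.2.2.2 k hk, fun l hl => ?_⟩
    have e0 : d (l + (k + 1)) = 1 := by
      have := h.1 (l + (k + 1))
      simp only [rf, tl] at hl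
      omega
    have e1 := h.2.2.2 _ e0
    have e2 : rf (tl (l + (k + 1) + 1) d) = tl (l + 1) (rf (tl (k + 1) d)) := by
      funext i; simp only [tl, rf]; congr 2; omega
    rwa [e2] at e1
  refine ⟨mem_USeq hq h.1 h0 h1, mem_USeq hq hr ?_ ?_⟩
  · intro k hk
    exact h1 k (by have := h.1 k; simp only [rf] at hk; omega)
  · intro k hk
    have : rf (tl (k + 1) (rf d)) = tl (k + 1) d := rf_rf (d := tl (k + 1) d) fun i => h.1 _
    rw [this]
    exact h0 k (by have := h.1 k; simp only [rf] at hk; omega)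

lemma lexLe_of_head {e a : ℕ → ℕ} (h : e 0 < a 0) : lexLe e a :=
  Or.inr ⟨0, by simp, h⟩

lemma sg_le {x : ℕ → ℕ} (hx : ∀ i, x i ≤ 1) (i : ℕ) : sg x i ≤ 1 := by
  have := hx (i / 2)
  simp only [sg]; split_ifs <;> omega

lemma cn_le {c : ℕ} {x : ℕ → ℕ} (hc : c ≤ 1) (hx : ∀ i, x i ≤ 1) (i : ℕ) : cn c x i ≤ 1 := by
  have := hx (i - 1)
  simp only [cn]; split_ifs <;> omega

lemma cn_sg_mono {x b : ℕ → ℕ} (h : lexLe x b) : lexLe (cn 1 (sg x)) (cn 1 (sg b)) := by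
  rcases h with h | ⟨n, h1, h2⟩
  · left; rw [h]
  right
  refine ⟨2 * n + 1, fun i hi => ?_, ?_⟩
  · simp only [cn, sg]
    rcases Nat.eq_zero_or_pos i with h | h
    · simp [h]
    · rw [h1 ((i - 1) / 2) (by omega)]
  · simp [cn, sg]
    exact h2

lemma sg_le_cn {y b : ℕ → ℕ} (hy : ∀ i, y i ≤ 1)
    (h : b 0 = 1 ∨ (b = (fun _ => 0) ∧ y = fun _ => 1)) : lexLe (sg y) (cn 1 (sg b)) := by
  rcases h with h | ⟨rfl, rfl⟩
  · rcases Nat.eq_zero_or_pos (y 0) with h0 | h0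
    · exact lexLe_of_head (by simp [sg, cn, h0])
    · have h1 : y 0 = 1 := by have := hy 0; omega
      right
      refine ⟨1, fun i hi => ?_, ?_⟩
      · have : i = 0 := by omega
        subst this
        simp [sg, cn, h1]
      · simp [sg, cn, h1, h]
  · left
    funext i
    simp only [sg, cn]
    split_ifs <;> omega

lemma rf_sg {y : ℕ → ℕ} (hy : ∀ i, y i ≤ 1) : rf (sg y) = sg (rf y) := by
  funext i
  have := hy (i / 2)
  simp only [sg, rf]
  split_ifs <;> omega

lemma rf_cn (c : ℕ) (y : ℕ → ℕ) : rf (cn c y) = cn (1 - c) (rf y) := by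
  funext i
  simp only [cn, rf]
  split_ifs <;> rfl

lemma tl_even (x : ℕ → ℕ) (s : ℕ) :
    tl (2 * s + 2) (cn 1 (sg x)) = cn (1 - x s) (sg (tl (s + 1) x)) := by
  funext i
  simp only [tl, cn, sg]
  rcases Nat.eq_zero_or_pos i with h | h
  · subst h
    have e1 : (0 + (2 * s + 2) - 1) % 2 = 1 := by omega
    have e2 : (0 + (2 * s + 2) - 1) / 2 = s := by omega
    rw [e1, e2]; simp
  · have e1 : (i + (2 * s + 2) - 1) % 2 = (i - 1) % 2 := by omega
    have e2 : (i + (2 * s + 2) - 1) / 2 = (i - 1) / 2 + (s + 1) := by omega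
    have e3 : i + (2 * s + 2) ≠ 0 := by omega
    have e4 : i ≠ 0 := by omega
    rw [e1, e2, if_neg e3, if_neg e4]

lemma tl_odd (x : ℕ → ℕ) (s : ℕ) :
    tl (2 * s + 1) (cn 1 (sg x)) = sg (tl s x) := by
  funext i
  simp only [tl, cn, sg]
  have e1 : (i + (2 * s + 1) - 1) % 2 = i % 2 := by omega
  have e2 : (i + (2 * s + 1) - 1) / 2 = i / 2 + s := by omega
  rw [e1, e2, if_neg (by omega)]

lemma Good.sub {b x : ℕ → ℕ} (h : Good b x)
    (hb : b 0 = 1 ∨ (b = (fun _ => 0) ∧ x = fun _ => 0)) :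
    Good (cn 1 (sg b)) (cn 1 (sg x)) := by
  have hr : ∀ y : ℕ → ℕ, ∀ i, rf y i ≤ 1 := fun y i => by simp only [rf]; omega
  have hA : ∀ s, lexLe (rf (sg (tl s x))) (cn 1 (sg b)) := by
    intro s
    rw [rf_sg (y := tl s x) fun i => h.1 _]
    refine sg_le_cn (hr _) ?_
    rcases hb with hb | ⟨hb, rfl⟩
    · exact Or.inl hb
    · exact Or.inr ⟨hb, rfl⟩
  refine ⟨cn_le le_rfl (sg_le h.1), cn_sg_mono h.2.1, fun k hk => ?_, fun k hk => ?_⟩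
  · rcases Nat.even_or_odd' k with ⟨s, rfl | rfl⟩
    · rcases s with _ | s
      · simp [cn] at hk
      · have hxs : x s = 1 := by
          have := h.1 s
          have e1 : (2 * (s + 1) - 1) % 2 = 1 := by omega
          have e2 : (2 * (s + 1) - 1) / 2 = s := by omega
          simp [cn, sg, e1, e2] at hk
          omega
        rw [tl_odd]
        refine sg_le_cn (fun i => h.1 _) ?_
        rcases hb with hb | ⟨hb, rfl⟩
        · exact Or.inl hb
        · simp at hxs
    · have hxs : x s = 0 := by simpa [cn, sg] using hk
      rw [tl_even, hxs]
      exact cn_sg_mono (h.2.2.1 s hxs)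
  · rcases Nat.even_or_odd' k with ⟨s, rfl | rfl⟩
    · rw [tl_odd]
      exact hA s
    · have hxs : x s = 1 := by simpa [cn, sg] using hk
      rw [tl_even, hxs, rf_cn, rf_sg (y := tl (s + 1) x) fun i => h.1 _]
      exact cn_sg_mono (h.2.2.2 s hxs)

lemma Good.cons0 {a d : ℕ → ℕ} (h : Good a d) (ha : a 0 = 1) : Good a (cn 0 d) := by
  have e : ∀ k, tl (k + 1) (cn 0 d) = tl k d := by
    intro k; funext i; simp only [tl, cn]; rw [if_neg (by omega)]; congr 1
  refine ⟨cn_le (by omega) h.1, lexLe_of_head (by simp [cn, ha]), fun k hk => ?_, fun k hk => ?_⟩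
  · rw [e]
    rcases k with _ | k
    · exact h.2.1
    · exact h.2.2.1 k (by simpa [cn] using hk)
  · rw [e]
    rcases k with _ | k
    · simp [cn] at hk
    · exact h.2.2.2 k (by simpa [cn] using hk)

/-- append a list to a sequence -/
def app : List ℕ → (ℕ → ℕ) → ℕ → ℕ
  | [], s => s
  | c :: l, s => cn c (app l s)

lemma app_append (l l' : List ℕ) (s : ℕ → ℕ) : app (l ++ l') s = app l (app l' s) := by
  induction l with
  | nil => rfl
  | cons c l ih => simp [app, ih]

lemma app_apply (l : List ℕ) (s : ℕ → ℕ) (i : ℕ) :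
    app l s i = if i < l.length then l.getD i 0 else s (i - l.length) := by
  induction l generalizing i with
  | nil => simp [app]
  | cons c l ih =>
    rcases i with _ | i
    · simp [app, cn]
    · simp [app, cn, ih]

/-- substitution on lists -/
def sgl : List ℕ → List ℕ
  | [] => []
  | c :: l => c :: (1 - c) :: sgl l

lemma sgl_append (l l' : List ℕ) : sgl (l ++ l') = sgl l ++ sgl l' := by
  induction l with
  | nil => rfl
  | cons c l ih => simp [sgl, ih]

lemma sg_cn (c : ℕ) (s : ℕ → ℕ) : sg (cn c s) = cn c (cn (1 - c) (sg s)) := by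
  funext i
  rcases i with _ | _ | i
  · simp [sg, cn]
  · simp [sg, cn]
  · have e1 : (i + 1 + 1) % 2 = i % 2 := by omega
    have e2 : (i + 1 + 1) / 2 = i / 2 + 1 := by omega
    simp [sg, cn, e1, e2]

lemma sg_app (l : List ℕ) (s : ℕ → ℕ) : sg (app l s) = app (sgl l) (sg s) := by
  induction l with
  | nil => rfl
  | cons c l ih => simp [app, sgl, ih, sg_cn]

/-- periodic -/
def per (w : List ℕ) : ℕ → ℕ := fun i => w.getD (i % w.length) 0

lemma prefPeriodic_eq (p w : List ℕ) : prefPeriodic p w = app p (per w) := by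
  funext i
  rw [app_apply]; rfl

lemma per_app (w : List ℕ) : per w = app w (per w) := by
  funext i
  rw [app_apply]
  split_ifs with h
  · simp only [per]; rw [Nat.mod_eq_of_lt h]
  · simp only [per]; rw [← Nat.mod_eq_sub_mod (by omega)]

lemma per_unique {w : List ℕ} (hw : w ≠ []) {s : ℕ → ℕ} (hs : s = app w s) : s = per w := by
  have hl : 0 < w.length := List.length_pos_iff.2 hw
  funext i
  induction i using Nat.strong_induction_on with
  | _ i ih =>
    rw [hs, per_app, app_apply, app_apply]
    split_ifs with h
    · rfl
    · exact ih _ (by omega)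

/-- the word `w_{N+1}` -/
def W (τ : ℕ → ℕ) (N : ℕ) : List ℕ := lastDec (tmPrefix τ (2 ^ N))

lemma tm_succ (τ : ℕ → ℕ) (M : ℕ) : tmPrefix τ (M + 1) = tmPrefix τ M ++ [τ (M + 1)] := by
  simp [tmPrefix, List.range_succ]

lemma tm_sgl {τ : ℕ → ℕ} (hτ : IsThueMorse τ) (M : ℕ) :
    1 :: sgl (tmPrefix τ M) = tmPrefix τ (2 * M + 1) := by
  have h1 : τ 1 = 1 := by have := hτ.2.2 0; simp [hτ.1] at this; exact this
  induction M with
  | zero => simp [tmPrefix, sgl, h1]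
  | succ M ih =>
    rw [tm_succ, sgl_append, ← List.cons_append, ih]
    rw [show 2 * (M + 1) + 1 = 2 * M + 1 + 1 + 1 by ring, tm_succ τ (2 * M + 1 + 1), tm_succ τ (2 * M + 1)]
    rw [show 2 * M + 1 + 1 = 2 * (M + 1) by ring, hτ.2.1, hτ.2.2]
    simp [sgl]

lemma tau_pow {τ : ℕ → ℕ} (hτ : IsThueMorse τ) (N : ℕ) : τ (2 ^ N) = 1 := by
  induction N with
  | zero => have := hτ.2.2 0; simp [hτ.1] at this; simpa using this
  | succ N ih => rw [pow_succ, mul_comm, hτ.2.1, ih]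

lemma W_eq {τ : ℕ → ℕ} (hτ : IsThueMorse τ) (N : ℕ) : W τ N = tmPrefix τ (2 ^ N - 1) ++ [0] := by
  have h : 2 ^ N = 2 ^ N - 1 + 1 := by have := Nat.two_pow_pos N; omega
  have h2 := tau_pow hτ N
  unfold W
  rw [h] at h2 ⊢
  rw [tm_succ, h2]
  simp [lastDec, List.getLastD_eq_getLast?]

lemma W_succ {τ : ℕ → ℕ} (hτ : IsThueMorse τ) (N : ℕ) : W τ (N + 1) ++ [1] = 1 :: sgl (W τ N) := by
  rw [W_eq hτ, W_eq hτ, sgl_append, ← List.cons_append, tm_sgl hτ]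
  have : 2 * (2 ^ N - 1) + 1 = 2 ^ (N + 1) - 1 := by
    have := Nat.two_pow_pos N; rw [pow_succ]; omega
  rw [this]; simp [sgl]

lemma W_ne {τ : ℕ → ℕ} (hτ : IsThueMorse τ) (N : ℕ) : W τ N ≠ [] := by
  rw [W_eq hτ]; simp

lemma W_zero {τ : ℕ → ℕ} (hτ : IsThueMorse τ) : W τ 0 = [0] := by
  rw [W_eq hτ]; simp [tmPrefix]

/-- the periodic sequence `w_{N+1}^∞` -/
def A (τ : ℕ → ℕ) (N : ℕ) : ℕ → ℕ := per (W τ N)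

lemma A_zero {τ : ℕ → ℕ} (hτ : IsThueMorse τ) : A τ 0 = fun _ => 0 := by
  unfold A; rw [W_zero hτ]; funext i; simp [per, Nat.mod_one]

lemma A_succ {τ : ℕ → ℕ} (hτ : IsThueMorse τ) (N : ℕ) : A τ (N + 1) = cn 1 (sg (A τ N)) := by
  symm
  refine per_unique (W_ne hτ _) ?_
  have h1 : app (W τ (N + 1)) (cn 1 (sg (A τ N))) = app (W τ (N + 1) ++ [1]) (sg (A τ N)) := by
    rw [app_append]; rfl
  rw [h1, W_succ hτ]
  show _ = cn 1 (app (sgl (W τ N)) (sg (A τ N)))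
  rw [← sg_app]
  congr 2
  exact per_app _

/-- prefix -/
def P (τ : ℕ → ℕ) (N : ℕ) (m : ℕ → ℕ) : List ℕ :=
  ((List.range N).map fun i => (List.replicate (m (i + 1)) (W τ i)).flatten).flatten

lemma rep_succ {τ : ℕ → ℕ} (hτ : IsThueMorse τ) (i k : ℕ) :
    (List.replicate k (W τ (i + 1))).flatten ++ [1] = 1 :: sgl (List.replicate k (W τ i)).flatten := by
  induction k with
  | zero => simp [sgl]
  | succ k ih =>
    rw [List.replicate_succ, List.replicate_succ, List.flatten_cons, List.flatten_cons,
      List.append_assoc, ih, sgl_append, ← List.cons_append, ← W_succ hτ]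
    simp

lemma P_succ {τ : ℕ → ℕ} (hτ : IsThueMorse τ) (N : ℕ) (m : ℕ → ℕ) :
    P τ (N + 1) m ++ [1] =
      List.replicate (m 1) 0 ++ 1 :: sgl (P τ N (fun i => m (i + 1))) := by
  induction N with
  | zero => simp [P, W_zero hτ, sgl]
  | succ N ih =>
    have e : ∀ N m, P τ (N + 1) m = P τ N m ++ (List.replicate (m (N + 1)) (W τ N)).flatten := by
      intro N m; simp [P, List.range_succ]
    rw [e (N + 1), e N (fun i => m (i + 1)), List.append_assoc, rep_succ hτ, sgl_append,
      ← List.cons_append, ← List.append_assoc (List.replicate (m 1) 0), ← ih]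
    simp

lemma app_P_succ {τ : ℕ → ℕ} (hτ : IsThueMorse τ) (N : ℕ) (m : ℕ → ℕ) :
    app (P τ (N + 1) m) (A τ (N + 1)) =
      app (List.replicate (m 1) 0) (cn 1 (sg (app (P τ N (fun i => m (i + 1))) (A τ N)))) := by
  have h1 : app (P τ (N + 1) m) (A τ (N + 1)) = app (P τ (N + 1) m ++ [1]) (sg (A τ N)) := by
    rw [A_succ hτ, app_append]; rfl
  rw [h1, P_succ hτ, app_append, sg_app]; rfl

lemma good_G {τ : ℕ → ℕ} (hτ : IsThueMorse τ) (N : ℕ) (m : ℕ → ℕ) :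
    Good (A τ N) (app (P τ N m) (A τ N)) := by
  induction N generalizing m with
  | zero =>
    have : app (P τ 0 m) (A τ 0) = A τ 0 := rfl
    rw [this, A_zero hτ]
    exact ⟨fun i => by simp, Or.inl rfl, fun k _ => Or.inl rfl, fun k hk => by simp at hk⟩
  | succ N ih =>
    rw [app_P_succ hτ, A_succ hτ]
    have hg : Good (cn 1 (sg (A τ N)))
        (cn 1 (sg (app (P τ N (fun i => m (i + 1))) (A τ N)))) := by
      refine (ih _).sub ?_
      rcases N with _ | N
      · exact Or.inr ⟨A_zero hτ, A_zero hτ⟩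
      · left; rw [A_succ hτ]; rfl
    generalize m 1 = k
    induction k with
    | zero => exact hg
    | succ k ihk => exact ihk.cons0 rfl

lemma A_le {τ : ℕ → ℕ} (hτ : IsThueMorse τ) (N : ℕ) (i : ℕ) : A τ N i ≤ 1 := by
  induction N generalizing i with
  | zero => simp [A_zero hτ]
  | succ N ih => rw [A_succ hτ]; exact cn_le le_rfl (sg_le ih) i

lemma val_A {τ : ℕ → ℕ} (hτ : IsThueMorse τ) (N : ℕ) {q : ℝ} (hq : 1 < q)
    (hf : ∑ i ∈ Finset.range (2 ^ N), (τ (i + 1) : ℝ) / q ^ (i + 1) < 1) :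
    seqVal q (A τ N) < 1 := by
  have hlen : (W τ N).length = 2 ^ N := by
    have := Nat.two_pow_pos N
    rw [W_eq hτ]; simp [tmPrefix]; omega
  have htl : tl (2 ^ N) (A τ N) = A τ N := by
    funext i; simp only [tl, A, per, hlen, Nat.add_mod_right]
  have hs := val_split hq (A_le hτ N) (2 ^ N)
  rw [htl] at hs
  obtain ⟨M, hM⟩ : ∃ M, 2 ^ N = M + 1 := ⟨2 ^ N - 1, by
    have := Nat.two_pow_pos N; omega⟩
  have hτM : τ (M + 1) = 1 := by rw [← hM]; exact tau_pow hτ N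
  have hW : W τ N = tmPrefix τ M ++ [0] := by rw [W_eq hτ, hM]; simp
  have hAM : A τ N M = 0 := by
    simp [A, per, hW, tmPrefix]
  have hAi : ∀ i < M, A τ N i = τ (i + 1) := by
    intro i hi
    have : i % (M + 1) = i := Nat.mod_eq_of_lt (by omega)
    simp [A, per, hW, tmPrefix, this, List.getElem?_append, hi]
  rw [hM] at hs hf
  rw [Finset.sum_range_succ] at hs hf
  rw [hAM, Finset.sum_congr rfl fun i hi => by rw [hAi i (Finset.mem_range.1 hi)]] at hs
  rw [hτM] at hf
  push_cast at hs hf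
  have hp : 1 < q ^ (M + 1) := one_lt_pow₀ hq (by omega)
  have hinv : 1 / q ^ (M + 1) < 1 := by rw [div_lt_one (by linarith)]; exact hp
  rw [zero_div, div_eq_mul_one_div (seqVal q (A τ N))] at hs
  by_contra hc
  push Not at hc
  nlinarith

lemma f_lt {τ : ℕ → ℕ} (hτ : IsThueMorse τ) {Q : ℕ → ℝ} (hQ : IsBaseSeq τ Q) (k : ℕ) {q : ℝ}
    (hq1 : 1 < q) (hq : Q k < q) :
    ∑ i ∈ Finset.range (2 ^ k), (τ (i + 1) : ℝ) / q ^ (i + 1) < 1 := by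
  have h1 : τ 1 = 1 := by have := hτ.2.2 0; simp [hτ.1] at this; exact this
  rcases Nat.eq_zero_or_pos k with rfl | hk
  · simp [h1]
    exact inv_lt_one_of_one_lt₀ hq1
  · obtain ⟨a, b, c⟩ := hQ.2 k hk
    rw [c]
    refine Finset.sum_lt_sum (fun i _ => ?_) ⟨0, by simp, ?_⟩
    · gcongr
    · simp [h1]
      gcongr

end GS

open GS in
/-- For `q ∈ (q_{n-1}, q_n]`, `1 ≤ j ≤ n` and nonnegative integers
`m_1, …, m_{j-1}`, the sequence `w_1^{m_1} ⋯ w_{j-1}^{m_{j-1}} w_j^∞` and its reflection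
belong to `U_q'`. -/
theorem glendinning_sidorov (τ : ℕ → ℕ) (hτ : IsThueMorse τ)
    (Q : ℕ → ℝ) (hQ : IsBaseSeq τ Q)
    (n : ℕ) (hn : 1 ≤ n) (q : ℝ) (hq : q ∈ Set.Ioc (Q (n - 1)) (Q n))
    (j : ℕ) (hj1 : 1 ≤ j) (hjn : j ≤ n) (m : ℕ → ℕ) :
    glendSeq τ j m ∈ USeq q ∧ (fun i => 1 - glendSeq τ j m i) ∈ USeq q := by
  have hq1 : 1 < q := by
    rcases Nat.eq_zero_or_pos (n - 1) with h | h
    · have := hq.1; rw [h, hQ.1] at this; exact this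
    · exact (hQ.2 _ h).1.trans hq.1
  have hf := f_lt hτ hQ (n - 1) hq1 hq.1
  have hf2 : ∑ i ∈ Finset.range (2 ^ (j - 1)), (τ (i + 1) : ℝ) / q ^ (i + 1) < 1 := by
    refine lt_of_le_of_lt (Finset.sum_le_sum_of_subset_of_nonneg ?_ ?_) hf
    · exact Finset.range_mono (Nat.pow_le_pow_right (by norm_num) (by omega))
    · intro i _ _; positivity
  have he : glendSeq τ j m = app (P τ (j - 1) m) (A τ (j - 1)) := prefPeriodic_eq _ _
  rw [he]
  exact (good_G hτ (j - 1) m).fin hq1 (A_le hτ _) (val_A hτ _ hq1 hf2)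
end
end

section
/- For every n ≥ 2, the half-open interval [z_n, z_{n−1}) is contained in D_n ∩ (1, ∞). -/
open Filter Topology

noncomputable section

/-! ### Basic facts about `seqVal` -/

lemma sv_summable {q : ℝ} (hq : 1 < q) {c : ℕ → ℕ} (hc : ∀ i, c i ≤ 1) :
    Summable (fun i : ℕ => (c i : ℝ) / q ^ (i + 1)) := by
  have h0 : (0 : ℝ) < q := by linarith
  have hg : Summable (fun i : ℕ => (1 / q) ^ (i + 1)) := by
    have := summable_geometric_of_lt_one (r := 1 / q) (by positivity)
      (by rw [div_lt_one h0]; exact hq)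
    exact (summable_nat_add_iff 1).2 this
  refine Summable.of_nonneg_of_le (fun i => by positivity) (fun i => ?_) hg
  rw [div_pow, one_pow]
  have : (c i : ℝ) ≤ 1 := by exact_mod_cast hc i
  gcongr

lemma sv_ones {q : ℝ} (hq : 1 < q) : seqVal q (fun _ => 1) = 1 / (q - 1) := by
  have h0 : (0 : ℝ) < q := by linarith
  have h1 : q - 1 ≠ 0 := by linarith
  unfold seqVal
  have : ∀ i : ℕ, ((1 : ℕ) : ℝ) / q ^ (i + 1) = (1 / q) * (1 / q) ^ i := by
    intro i
    rw [div_pow, one_pow, pow_succ]; push_cast; field_simp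
  simp_rw [this]
  rw [tsum_mul_left, tsum_geometric_of_lt_one (by positivity)
    (by rw [div_lt_one h0]; exact hq)]
  have : 1 - 1 / q ≠ 0 := by
    have : 1 / q < 1 := by rw [div_lt_one h0]; exact hq
    linarith
  field_simp

lemma sv_nonneg {q : ℝ} (hq : 1 < q) (c : ℕ → ℕ) : 0 ≤ seqVal q c :=
  tsum_nonneg fun i => by
    have h0 : (0 : ℝ) < q := by linarith
    positivity

lemma sv_le {q : ℝ} (hq : 1 < q) {c : ℕ → ℕ} (hc : ∀ i, c i ≤ 1) :
    seqVal q c ≤ 1 / (q - 1) := by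
  have h0 : (0 : ℝ) < q := by linarith
  rw [← sv_ones hq]
  refine Summable.tsum_le_tsum (fun i => ?_) (sv_summable hq hc)
    (sv_summable hq (fun _ => le_rfl))
  have : (c i : ℝ) ≤ ((1 : ℕ) : ℝ) := by exact_mod_cast hc i
  gcongr

lemma sv_refl {q : ℝ} (hq : 1 < q) {c : ℕ → ℕ} (hc : ∀ i, c i ≤ 1) :
    seqVal q (fun i => 1 - c i) = 1 / (q - 1) - seqVal q c := by
  rw [← sv_ones hq, eq_sub_iff_add_eq]
  unfold seqVal
  rw [← Summable.tsum_add (sv_summable hq (fun i => Nat.sub_le _ _)) (sv_summable hq hc)]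
  congr 1; ext i
  have := hc i
  rw [← add_div, ← Nat.cast_add, Nat.sub_add_cancel this]

lemma sv_split {q : ℝ} (hq : 1 < q) {c : ℕ → ℕ} (hc : ∀ i, c i ≤ 1) (n : ℕ) :
    seqVal q c = (∑ i ∈ Finset.range n, (c i : ℝ) / q ^ (i + 1))
      + 1 / q ^ n * seqVal q (fun i => c (n + i)) := by
  have h0 : (0 : ℝ) < q := by linarith
  unfold seqVal
  rw [← (sv_summable hq hc).sum_add_tsum_nat_add n, ← tsum_mul_left]
  congr 2; ext i
  rw [add_comm i n, show n + i + 1 = n + (i + 1) by ring, pow_add]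
  field_simp

lemma sv_mono {κ q : ℝ} (hκ : 1 < κ) (hq : κ < q) {c : ℕ → ℕ} (hc : ∀ i, c i ≤ 1) :
    seqVal q c ≤ κ / q * seqVal κ c := by
  have h0 : (0 : ℝ) < κ := by linarith
  have h1 : (0 : ℝ) < q := by linarith
  unfold seqVal
  rw [← tsum_mul_left]
  refine Summable.tsum_le_tsum (fun i => ?_) (sv_summable (hκ.trans hq) hc)
    ((sv_summable hκ hc).mul_left _)
  have h2 : κ / q * ((c i : ℝ) / κ ^ (i + 1)) = (c i : ℝ) / (q * κ ^ i) := by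
    rw [pow_succ]; field_simp
  rw [h2, pow_succ, mul_comm q]
  gcongr

/-! ### Uniqueness criterion -/

lemma unique_of_tails {q : ℝ} (hq : 1 < q) {d : ℕ → ℕ} (hd : ∀ i, d i ≤ 1)
    (h0 : ∀ i, d i = 0 → seqVal q (fun j => d (i + 1 + j)) < 1)
    (h1 : ∀ i, d i = 1 → 1 / (q - 1) - seqVal q (fun j => d (i + 1 + j)) < 1) :
    ∀ e : ℕ → ℕ, IsExpansion q (seqVal q d) e → e = d := by
  intro e he
  obtain ⟨he, hv⟩ := he
  have hq0 : (0 : ℝ) < q := by linarith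
  by_contra hne
  have hex : ∃ i, e i ≠ d i := by
    by_contra hcon
    push Not at hcon
    exact hne (funext hcon)
  classical
  let i := Nat.find hex
  have hi : e i ≠ d i := Nat.find_spec hex
  have hlt : ∀ j, j < i → e j = d j := fun j hj => by
    have := Nat.find_min hex hj
    push Not at this
    exact this
  rw [sv_split hq hd (i + 1), sv_split hq he (i + 1), Finset.sum_range_succ,
    Finset.sum_range_succ] at hv
  have hs : ∑ j ∈ Finset.range i, (e j : ℝ) / q ^ (j + 1)
      = ∑ j ∈ Finset.range i, (d j : ℝ) / q ^ (j + 1) :=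
    Finset.sum_congr rfl fun j hj => by rw [hlt j (Finset.mem_range.1 hj)]
  rw [hs] at hv
  have hP : (0 : ℝ) < 1 / q ^ (i + 1) := by positivity
  have e1 : (d i : ℝ) + seqVal q (fun j => d (i + 1 + j))
      = e i + seqVal q (fun j => e (i + 1 + j)) := by
    have : 1 / q ^ (i + 1) * ((d i : ℝ) + seqVal q (fun j => d (i + 1 + j)))
      = 1 / q ^ (i + 1) * (e i + seqVal q (fun j => e (i + 1 + j))) := by
      have a1 := div_eq_mul_one_div (d i : ℝ) (q ^ (i + 1))
      have a2 := div_eq_mul_one_div (e i : ℝ) (q ^ (i + 1))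
      rw [a1, a2] at hv
      linarith
    exact mul_left_cancel₀ hP.ne' this
  have n1 := sv_nonneg hq (fun j => e (i + 1 + j))
  have n2 := sv_le hq (c := fun j => e (i + 1 + j)) (fun j => he _)
  have := hd i
  have := he i
  rcases Nat.lt_or_ge (d i) 1 with h | h
  · have hd0 : d i = 0 := by omega
    have he1 : e i = 1 := by omega
    have := h0 i hd0
    rw [hd0, he1] at e1
    push_cast at e1
    linarith
  · have hd0 : d i = 1 := by omega
    have he1 : e i = 0 := by omega
    have := h1 i hd0
    rw [hd0, he1] at e1
    push_cast at e1
    linarith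

/-! ### Lexicographic comparison -/

/-- Weak lexicographic order. -/
def LexLe (c a : ℕ → ℕ) : Prop := (∀ i, c i = a i) ∨ ∃ n, (∀ i, i < n → c i = a i) ∧ c n < a n

lemma lex_bound {κ : ℝ} (hκ : 1 < κ) {a : ℕ → ℕ} (ha : ∀ i, a i ≤ 1) (ha0 : a 0 = 0)
    (hav : seqVal κ (fun i => a (i + 1)) = 1) (m : ℕ) :
    ∀ c : ℕ → ℕ, (∀ i, c i ≤ 1) → c 0 = 0 →
      (∀ i, c i = 0 → LexLe (fun j => c (i + j)) a) →
      seqVal κ (fun i => c (i + 1)) ≤ 1 + (1 / κ) ^ m * (1 / (κ - 1)) := by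
  have h0 : (0 : ℝ) < κ := by linarith
  have hk1 : (0 : ℝ) < κ - 1 := by linarith
  have hr : 1 / κ ≤ 1 := by rw [div_le_one h0]; exact hκ.le
  induction m with
  | zero =>
    intro c hc _ _
    have := sv_le hκ (c := fun i => c (i + 1)) (fun i => hc _)
    simp only [pow_zero, one_mul]
    linarith
  | succ m ih =>
    intro c hc c0 h
    have hpos : 0 ≤ (1 / κ) ^ (m + 1) * (1 / (κ - 1)) := by positivity
    rcases h 0 c0 with h1 | ⟨n, h1, h2⟩
    · have : (fun i => c (i + 1)) = fun i => a (i + 1) := by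
        ext i; simpa using h1 (i + 1)
      rw [this, hav]; linarith
    · simp only [zero_add] at h1 h2
      have han := ha n
      have hcn : c n = 0 := by omega
      have han : a n = 1 := by omega
      obtain ⟨k, rfl⟩ : ∃ k, n = k + 1 := by
        cases n with
        | zero => omega
        | succ k => exact ⟨k, rfl⟩
      have hI := ih (fun j => c (k + 1 + j)) (fun _ => hc _) hcn (fun i hi => by
        have := h (k + 1 + i) hi
        simpa [add_assoc] using this)
      rw [sv_split hκ (fun i => hc _) (k + 1), Finset.sum_range_succ]
      rw [sv_split hκ (fun i => ha _) (k + 1), Finset.sum_range_succ] at hav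
      rw [hcn]
      rw [han] at hav
      have hs : ∑ j ∈ Finset.range k, (c (j + 1) : ℝ) / κ ^ (j + 1)
          = ∑ j ∈ Finset.range k, (a (j + 1) : ℝ) / κ ^ (j + 1) :=
        Finset.sum_congr rfl fun j hj => by
          rw [h1 (j + 1) (by have := Finset.mem_range.1 hj; omega)]
      rw [hs]
      have hn := sv_nonneg hκ (fun i => a (k + 1 + i + 1))
      have hP : (0 : ℝ) < 1 / κ ^ (k + 1) := by positivity
      have hP2 : 1 / κ ^ (k + 1) ≤ 1 / κ := by
        rw [← one_div_pow]
        calc (1 / κ) ^ (k + 1) ≤ (1 / κ) ^ 1 :=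
              pow_le_pow_of_le_one (by positivity) hr (by omega)
          _ = 1 / κ := pow_one _
      have e : (fun i => c (k + 1 + i + 1)) = fun i => c (k + 1 + (i + 1)) := by
        ext i; rw [add_assoc]
      rw [e]
      have g1 := mul_le_mul_of_nonneg_left hI hP.le
      have g2 : 1 / κ ^ (k + 1) * ((1 / κ) ^ m * (1 / (κ - 1)))
          ≤ 1 / κ * ((1 / κ) ^ m * (1 / (κ - 1))) := by gcongr
      have g3 := mul_nonneg hP.le hn
      have g4 : (1 / κ) ^ (m + 1) * (1 / (κ - 1)) = 1 / κ * ((1 / κ) ^ m * (1 / (κ - 1))) := by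
        rw [pow_succ]; ring
      push_cast at *
      rw [g4]
      have z0 : (0 : ℝ) / κ ^ (k + 1) = 0 := zero_div _
      linarith

lemma lex_val_lt {κ q : ℝ} (hκ : 1 < κ) (hq : κ < q) {a : ℕ → ℕ} (ha : ∀ i, a i ≤ 1)
    (ha0 : a 0 = 0) (hav : seqVal κ (fun i => a (i + 1)) = 1)
    (c : ℕ → ℕ) (hc : ∀ i, c i ≤ 1) (c0 : c 0 = 0)
    (h : ∀ i, c i = 0 → LexLe (fun j => c (i + j)) a) :
    seqVal q (fun i => c (i + 1)) < 1 := by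
  have h0 : (0 : ℝ) < κ := by linarith
  have hle : seqVal κ (fun i => c (i + 1)) ≤ 1 := by
    have ht : Tendsto (fun m : ℕ => 1 + (1 / κ) ^ m * (1 / (κ - 1))) atTop
        (𝓝 (1 + 0 * (1 / (κ - 1)))) :=
      ((tendsto_pow_atTop_nhds_zero_of_lt_one (by positivity)
        (by rw [div_lt_one h0]; exact hκ)).mul_const _).const_add _
    rw [zero_mul, add_zero] at ht
    exact ge_of_tendsto' ht fun m => lex_bound hκ ha ha0 hav m c hc c0 h
  have h1 := sv_mono hκ hq (c := fun i => c (i + 1)) (fun i => hc _)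
  have h2 : κ / q < 1 := by rw [div_lt_one (by linarith)]; exact hq
  have h3 : 0 < κ / q := by apply div_pos <;> linarith
  nlinarith

/-- The property used for the univoque sequences (only positions `i ≥ 1`). -/
def LexStar (d a : ℕ → ℕ) : Prop := ∀ i, 1 ≤ i →
  (d i = 0 → LexLe (fun j => d (i + j)) a) ∧ (d i = 1 → LexLe (fun j => 1 - d (i + j)) a)

lemma star_unique {κ q : ℝ} (hκ : 1 < κ) (hq : κ < q) {a d : ℕ → ℕ} (ha : ∀ i, a i ≤ 1)
    (ha0 : a 0 = 0) (hav : seqVal κ (fun i => a (i + 1)) = 1) (hd : ∀ i, d i ≤ 1)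
    (h : LexStar d a) :
    ∀ e : ℕ → ℕ, IsExpansion q (seqVal q (fun i => d (i + 1))) e → e = fun i => d (i + 1) := by
  have hq1 : 1 < q := hκ.trans hq
  refine unique_of_tails hq1 (fun i => hd _) (fun i hi => ?_) (fun i hi => ?_)
  · have := lex_val_lt hκ hq ha ha0 hav (fun j => d (i + 1 + j)) (fun _ => hd _) hi
      (fun l hl => by
        have := (h (i + 1 + l) (by omega)).1 hl
        simpa [add_assoc] using this)
    simpa [add_assoc] using this
  · have := lex_val_lt hκ hq ha ha0 hav (fun j => 1 - d (i + 1 + j)) (fun _ => Nat.sub_le _ _)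
      (by simp only [add_zero]; omega)
      (fun l hl => by
        have h2 := hd (i + 1 + l)
        have := (h (i + 1 + l) (by omega)).2 (by omega)
        simpa [add_assoc] using this)
    rw [sv_refl hq1 (fun _ => hd _)] at this
    simpa [add_assoc] using this

/-- doubling step -/
lemma star_double {d a d' a' : ℕ → ℕ} (hd : ∀ i, d i ≤ 1)
    (hd0 : ∀ i, d' (2 * i) = d i) (hd1 : ∀ i, d' (2 * i + 1) = 1 - d i)
    (ha0 : ∀ i, a' (2 * i) = a i) (ha1 : ∀ i, a' (2 * i + 1) = 1 - a i)
    (a0 : a 0 = 0) (a1 : a 1 = 1) (h : LexStar d a) : LexStar d' a' := by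
  have lex : ∀ (c c' : ℕ → ℕ), (∀ i, c' (2 * i) = c i) → (∀ i, c' (2 * i + 1) = 1 - c i) →
      LexLe c a → LexLe c' a' := by
    intro c c' h0 h1 hl
    rcases hl with hl | ⟨n, hl, hn⟩
    · left
      intro i
      rcases Nat.even_or_odd' i with ⟨k, rfl | rfl⟩
      · rw [h0, ha0, hl]
      · rw [h1, ha1, hl]
    · right
      refine ⟨2 * n, fun i hi => ?_, by rw [h0, ha0]; exact hn⟩
      rcases Nat.even_or_odd' i with ⟨k, rfl | rfl⟩
      · rw [h0, ha0, hl k (by omega)]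
      · rw [h1, ha1, hl k (by omega)]
  have b0 : a' 0 = 0 := by have := ha0 0; simpa [a0] using this
  have b1 : a' 1 = 1 := by have := ha1 0; simpa [a0] using this
  have b2 : a' 2 = 1 := by have := ha0 1; simpa [a1] using this
  have odd : ∀ c : ℕ → ℕ, c 0 = 0 → c 1 ≤ 1 → c 2 = 1 - c 1 → LexLe c a' := by
    intro c c0 c1 c2
    right
    rcases Nat.lt_or_ge (c 1) 1 with hc | hc
    · refine ⟨1, fun i hi => ?_, by omega⟩
      obtain rfl : i = 0 := by omega
      omega
    · refine ⟨2, fun i hi => ?_, by omega⟩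
      have : i = 0 ∨ i = 1 := by omega
      rcases this with rfl | rfl <;> omega
  intro i hi
  rcases Nat.even_or_odd' i with ⟨k, rfl | rfl⟩
  · have hk := h k (by omega)
    constructor
    · intro hz
      rw [hd0] at hz
      refine lex _ _ (fun i => ?_) (fun i => ?_) (hk.1 hz)
      · rw [← mul_add, hd0]
      · rw [← add_assoc, ← mul_add, hd1]
    · intro hz
      rw [hd0] at hz
      refine lex _ _ (fun i => ?_) (fun i => ?_) (hk.2 hz)
      · rw [← mul_add, hd0]
      · rw [← add_assoc, ← mul_add, hd1]
  · have e1 : d' (2 * k + 1 + 1) = d (k + 1) := hd0 (k + 1)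
    have e2 : d' (2 * k + 1 + 2) = 1 - d (k + 1) := hd1 (k + 1)
    have := hd (k + 1)
    constructor
    · intro hz
      refine odd _ hz ?_ ?_
      · simp only [e1]; omega
      · simp only [e1, e2]
    · intro hz
      refine odd _ ?_ ?_ ?_
      · simp only [add_zero]; omega
      · omega
      · simp only [e1, e2]

/-! ### The sequences -/

section TM
variable {τ : ℕ → ℕ}

lemma tm_le (hτ : IsThueMorse τ) (i : ℕ) : τ i ≤ 1 := by
  obtain ⟨h0, h1, h2⟩ := hτ
  induction i using Nat.strong_induction_on with
  | _ i ih =>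
    rcases Nat.even_or_odd' i with ⟨k, rfl | rfl⟩
    · rcases Nat.eq_zero_or_pos k with rfl | hk
      · simp [h0]
      · rw [h1]; exact ih k (by omega)
    · rw [h2]; omega

lemma tm_one (hτ : IsThueMorse τ) : τ 1 = 1 := by
  have := hτ.2.2 0
  simpa [hτ.1] using this

lemma tm_pow (hτ : IsThueMorse τ) (m : ℕ) : τ (2 ^ m) = 1 := by
  induction m with
  | zero => simpa using tm_one hτ
  | succ m ih => rw [pow_succ, mul_comm, hτ.2.1, ih]

lemma tm_add (hτ : IsThueMorse τ) (m : ℕ) : ∀ i, i < 2 ^ m → τ (2 ^ m + i) = 1 - τ i := by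
  induction m with
  | zero =>
    intro i hi
    obtain rfl : i = 0 := by simpa using hi
    simp [tm_one hτ, hτ.1]
  | succ m ih =>
    intro i hi
    rw [pow_succ] at hi ⊢
    rcases Nat.even_or_odd' i with ⟨k, rfl | rfl⟩
    · rw [show 2 ^ m * 2 + 2 * k = 2 * (2 ^ m + k) by ring, hτ.2.1, hτ.2.1, ih k (by omega)]
    · rw [show 2 ^ m * 2 + (2 * k + 1) = 2 * (2 ^ m + k) + 1 by ring, hτ.2.2, hτ.2.2,
        ih k (by omega)]

/-- quasi-greedy sequence, with a zeroth digit `0` -/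
def aS (τ : ℕ → ℕ) (m : ℕ) (j : ℕ) : ℕ := τ (j % 2 ^ (m + 1))

/-- tail sequence -/
def sS (τ : ℕ → ℕ) (m k : ℕ) (j : ℕ) : ℕ :=
  if j < k * 2 ^ m then 1 - τ (j % 2 ^ m) else 1 - τ ((j - k * 2 ^ m) % 2 ^ (m + 1))

/-- univoque sequence -/
def dS (τ : ℕ → ℕ) (m k : ℕ) (j : ℕ) : ℕ :=
  if j < 2 ^ m then τ j else sS τ m k (j - 2 ^ m)

lemma sS_le (_hτ : IsThueMorse τ) (m k j : ℕ) : sS τ m k j ≤ 1 := by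
  unfold sS; split_ifs <;> omega

lemma dS_le (hτ : IsThueMorse τ) (m k j : ℕ) : dS τ m k j ≤ 1 := by
  unfold dS; split_ifs
  · exact tm_le hτ j
  · exact sS_le hτ _ _ _

lemma tm_mod_even (hτ : IsThueMorse τ) (m i : ℕ) : τ ((2 * i) % 2 ^ (m + 1)) = τ (i % 2 ^ m) := by
  rw [pow_succ, mul_comm (2 ^ m), Nat.mul_mod_mul_left, hτ.2.1]

lemma tm_mod_odd (hτ : IsThueMorse τ) (m i : ℕ) :
    τ ((2 * i + 1) % 2 ^ (m + 1)) = 1 - τ (i % 2 ^ m) := by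
  have : (2 * i + 1) % 2 ^ (m + 1) = 2 * (i % 2 ^ m) + 1 := by
    rw [pow_succ, mul_comm (2 ^ m)]
    have h1 := Nat.div_add_mod i (2 ^ m)
    have h2 : i % 2 ^ m < 2 ^ m := Nat.mod_lt _ (by positivity)
    rw [show 2 * i + 1 = (2 * (i % 2 ^ m) + 1) + 2 * 2 ^ m * (i / 2 ^ m) by
      nlinarith [h1], Nat.add_mul_mod_self_left, Nat.mod_eq_of_lt (by omega)]
  rw [this, hτ.2.2]

lemma sS_even (hτ : IsThueMorse τ) (m k i : ℕ) : sS τ (m + 1) k (2 * i) = sS τ m k i := by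
  unfold sS
  have e : k * 2 ^ (m + 1) = 2 * (k * 2 ^ m) := by ring
  rw [e]
  by_cases h : i < k * 2 ^ m
  · rw [if_pos h, if_pos (by omega), tm_mod_even hτ]
  · rw [if_neg h, if_neg (by omega), ← Nat.mul_sub, tm_mod_even hτ]

lemma sS_odd (hτ : IsThueMorse τ) (m k i : ℕ) : sS τ (m + 1) k (2 * i + 1) = 1 - sS τ m k i := by
  unfold sS
  have e : k * 2 ^ (m + 1) = 2 * (k * 2 ^ m) := by ring
  rw [e]
  by_cases h : i < k * 2 ^ m
  · rw [if_pos h, if_pos (by omega), tm_mod_odd hτ]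
  · rw [if_neg h, if_neg (by omega),
      show 2 * i + 1 - 2 * (k * 2 ^ m) = 2 * (i - k * 2 ^ m) + 1 by omega, tm_mod_odd hτ]

lemma star_dS (hτ : IsThueMorse τ) (m k : ℕ) : LexStar (dS τ m k) (aS τ m) := by
  induction m with
  | zero =>
    have hpar : ∀ j : ℕ, τ (j % 2) = j % 2 := by
      intro j
      have : j % 2 = 0 ∨ j % 2 = 1 := by omega
      rcases this with h | h <;> rw [h]
      · exact hτ.1
      · exact tm_one hτ
    have hD : ∀ j, 1 ≤ j → dS τ 0 k j =
        if j ≤ k then 1 else 1 - (j - 1 - k) % 2 := by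
      intro j hj
      unfold dS sS
      simp only [pow_zero, zero_add, pow_one, mul_one, Nat.mod_one, hτ.1, hpar]
      rw [if_neg (by omega)]
      by_cases h : j ≤ k
      · rw [if_pos h, if_pos (by omega)]
      · rw [if_neg h, if_neg (by omega)]
    have hA : ∀ j, aS τ 0 j = j % 2 := by
      intro j; unfold aS; simp [hpar]
    intro i hi
    constructor
    · intro hz
      rw [hD i hi] at hz
      left
      intro j
      simp only
      rw [hD _ (by omega), hA]
      split_ifs at hz ⊢ <;> omega
    · intro hz
      rw [hD i hi] at hz
      by_cases hik : i + 1 ≤ k + 1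
      · right
        refine ⟨1, fun j hj => ?_, ?_⟩
        · obtain rfl : j = 0 := by omega
          simp only
          rw [hD _ (by omega), hA]
          split_ifs <;> omega
        · simp only
          rw [hD _ (by omega), hA]
          split_ifs <;> omega
      · left
        intro j
        simp only
        rw [hD _ (by omega), hA]
        split_ifs at hz ⊢ <;> omega
  | succ m ih =>
    refine star_double (dS_le hτ m k) (fun i => ?_) (fun i => ?_) (fun i => ?_) (fun i => ?_)
      ?_ ?_ ih
    · unfold dS
      rw [pow_succ]
      by_cases h : i < 2 ^ m
      · rw [if_pos h, if_pos (by omega), hτ.2.1]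
      · rw [if_neg h, if_neg (by omega), show 2 * i - 2 ^ m * 2 = 2 * (i - 2 ^ m) by omega,
          sS_even hτ]
    · unfold dS
      rw [pow_succ]
      by_cases h : i < 2 ^ m
      · rw [if_pos h, if_pos (by omega), hτ.2.2]
      · rw [if_neg h, if_neg (by omega),
          show 2 * i + 1 - 2 ^ m * 2 = 2 * (i - 2 ^ m) + 1 by omega, sS_odd hτ]
    · exact tm_mod_even hτ _ _
    · exact tm_mod_odd hτ _ _
    · unfold aS; simp [hτ.1]
    · unfold aS
      rw [Nat.mod_eq_of_lt (Nat.one_lt_two_pow (by omega)), tm_one hτ]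

end TM

/-! ### Values -/

/-- value of the word `τ_1 ⋯ τ_{2^m}` -/
def Wf (τ : ℕ → ℕ) (m : ℕ) (q : ℝ) : ℝ :=
  ∑ i ∈ Finset.range (2 ^ m), (τ (i + 1) : ℝ) / q ^ (i + 1)

/-- value of the reflected word -/
def Vf (τ : ℕ → ℕ) (m : ℕ) (q : ℝ) : ℝ :=
  ∑ i ∈ Finset.range (2 ^ m), (1 - (τ (i + 1) : ℝ)) / q ^ (i + 1)

/-- `q^(-2^m)` -/
def pf (m : ℕ) (q : ℝ) : ℝ := 1 / q ^ (2 ^ m)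

/-- values of the tail sequences -/
def Sf (τ : ℕ → ℕ) (m : ℕ) : ℕ → ℝ → ℝ
  | 0, q => (Vf τ m q + pf m q * Wf τ m q) / (1 - pf m q ^ 2)
  | k + 1, q => Vf τ m q + pf m q + pf m q * Sf τ m k q

section Values
variable {τ : ℕ → ℕ}

lemma pf_succ (m : ℕ) (q : ℝ) : pf (m + 1) q = pf m q ^ 2 := by
  unfold pf
  rw [div_pow, one_pow, ← pow_mul, pow_succ]

lemma pf_pos (m : ℕ) {q : ℝ} (hq : 1 < q) : 0 < pf m q := by
  unfold pf
  have : (0 : ℝ) < q := by linarith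
  positivity

lemma pf_le (m : ℕ) {q : ℝ} (hq : 1 < q) : pf m q ≤ 1 / q := by
  unfold pf
  have : (0 : ℝ) < q := by linarith
  have h : q ≤ q ^ (2 ^ m) := le_self_pow₀ hq.le (by positivity)
  gcongr

lemma pf_lt_one (m : ℕ) {q : ℝ} (hq : 1 < q) : pf m q < 1 := by
  have h0 : (0 : ℝ) < q := by linarith
  refine (pf_le m hq).trans_lt ?_
  rw [div_lt_one h0]; exact hq

lemma block_V (hτ : IsThueMorse τ) (m : ℕ) (q : ℝ) (c : ℕ → ℕ)
    (hc : ∀ i, i < 2 ^ m → c i = 1 - τ ((i + 1) % 2 ^ m)) :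
    ∑ i ∈ Finset.range (2 ^ m), (c i : ℝ) / q ^ (i + 1) = Vf τ m q + pf m q := by
  unfold Vf pf
  have h1 := tm_pow hτ m
  obtain ⟨M, hM⟩ : ∃ M, 2 ^ m = M + 1 := ⟨2 ^ m - 1, by have := Nat.two_pow_pos m; omega⟩
  rw [hM] at hc h1 ⊢
  rw [Finset.sum_range_succ, Finset.sum_range_succ, h1, hc M (by omega), Nat.mod_self, hτ.1]
  have : ∑ i ∈ Finset.range M, (c i : ℝ) / q ^ (i + 1)
      = ∑ i ∈ Finset.range M, (1 - (τ (i + 1) : ℝ)) / q ^ (i + 1) := by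
    refine Finset.sum_congr rfl fun i hi => ?_
    have hi := Finset.mem_range.1 hi
    rw [hc i (by omega), Nat.mod_eq_of_lt (by omega), Nat.cast_sub (tm_le hτ _)]
    push_cast; ring
  rw [this]
  push_cast
  ring

lemma block_W (hτ : IsThueMorse τ) (m : ℕ) (q : ℝ) :
    ∑ i ∈ Finset.range (2 ^ m), (τ ((i + 1) % 2 ^ m) : ℝ) / q ^ (i + 1)
      = Wf τ m q - pf m q := by
  unfold Wf pf
  have h1 := tm_pow hτ m
  obtain ⟨M, hM⟩ : ∃ M, 2 ^ m = M + 1 := ⟨2 ^ m - 1, by have := Nat.two_pow_pos m; omega⟩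
  rw [hM] at h1 ⊢
  rw [Finset.sum_range_succ, Finset.sum_range_succ, h1, Nat.mod_self, hτ.1]
  have : ∑ i ∈ Finset.range M, (τ ((i + 1) % (M + 1)) : ℝ) / q ^ (i + 1)
      = ∑ i ∈ Finset.range M, (τ (i + 1) : ℝ) / q ^ (i + 1) := by
    refine Finset.sum_congr rfl fun i hi => ?_
    have hi := Finset.mem_range.1 hi
    rw [Nat.mod_eq_of_lt (by omega)]
  rw [this]
  push_cast
  ring

lemma tm_block (hτ : IsThueMorse τ) (m i : ℕ) (hi : i < 2 ^ m) :
    τ (2 ^ m + (i + 1)) = 1 - τ ((i + 1) % 2 ^ m) := by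
  rcases Nat.lt_or_ge (i + 1) (2 ^ m) with h | h
  · rw [Nat.mod_eq_of_lt h, tm_add hτ m _ h]
  · have : i + 1 = 2 ^ m := by omega
    rw [this, Nat.mod_self, hτ.1, ← two_mul, hτ.2.1, tm_pow hτ]

lemma Wf_succ (hτ : IsThueMorse τ) (m : ℕ) {q : ℝ} (hq : 1 < q) :
    Wf τ (m + 1) q = Wf τ m q + pf m q * (Vf τ m q + pf m q) := by
  have h0 : (0 : ℝ) < q := by linarith
  rw [← block_V hτ m q (fun i => τ (2 ^ m + (i + 1))) (fun i hi => tm_block hτ m i hi),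
    Finset.mul_sum]
  unfold Wf pf
  rw [pow_succ, mul_two, Finset.sum_range_add]
  congr 1
  refine Finset.sum_congr rfl fun i _ => ?_
  rw [add_assoc, pow_add]
  field_simp

lemma Vf_succ (hτ : IsThueMorse τ) (m : ℕ) {q : ℝ} (hq : 1 < q) :
    Vf τ (m + 1) q = Vf τ m q + pf m q * (Wf τ m q - pf m q) := by
  have h0 : (0 : ℝ) < q := by linarith
  have h1 := block_W hτ m q
  rw [← h1, Finset.mul_sum]
  unfold Vf pf
  rw [pow_succ, mul_two, Finset.sum_range_add]
  congr 1
  refine Finset.sum_congr rfl fun i hi => ?_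
  rw [add_assoc, pow_add, tm_block hτ m i (Finset.mem_range.1 hi), Nat.cast_sub (tm_le hτ _)]
  push_cast
  field_simp
  ring

lemma Vf_nonneg (hτ : IsThueMorse τ) (m : ℕ) {q : ℝ} (hq : 1 < q) : 0 ≤ Vf τ m q := by
  have h0 : (0 : ℝ) < q := by linarith
  refine Finset.sum_nonneg fun i _ => ?_
  have : (τ (i + 1) : ℝ) ≤ 1 := by exact_mod_cast tm_le hτ _
  exact div_nonneg (by linarith) (by positivity)

lemma Wf_pos (hτ : IsThueMorse τ) (m : ℕ) {q : ℝ} (hq : 1 < q) : 0 < Wf τ m q := by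
  have h0 : (0 : ℝ) < q := by linarith
  refine Finset.sum_pos' (fun i _ => by positivity) ⟨0, by simp, ?_⟩
  rw [zero_add, tm_one hτ]
  positivity

lemma Vf_anti (hτ : IsThueMorse τ) (m : ℕ) {κ q : ℝ} (hκ : 1 < κ) (hq : κ ≤ q) :
    Vf τ m q ≤ Vf τ m κ := by
  have h0 : (0 : ℝ) < κ := by linarith
  refine Finset.sum_le_sum fun i _ => ?_
  have : (τ (i + 1) : ℝ) ≤ 1 := by exact_mod_cast tm_le hτ _
  have : 0 ≤ 1 - (τ (i + 1) : ℝ) := by linarith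
  gcongr

lemma Wf_anti (m : ℕ) {κ q : ℝ} (hκ : 1 < κ) (hq : κ ≤ q) :
    Wf τ m q ≤ Wf τ m κ := by
  have h0 : (0 : ℝ) < κ := by linarith
  refine Finset.sum_le_sum fun i _ => ?_
  gcongr

lemma pf_anti (m : ℕ) {κ q : ℝ} (hκ : 1 < κ) (hq : κ ≤ q) : pf m q ≤ pf m κ := by
  have h0 : (0 : ℝ) < κ := by linarith
  unfold pf
  gcongr

lemma Sf_zero_eq (m : ℕ) {q : ℝ} (hq : 1 < q) :
    Sf τ m 0 q * (1 - pf m q ^ 2) = Vf τ m q + pf m q * Wf τ m q := by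
  have h1 := pf_pos m hq
  have h2 := pf_lt_one m hq
  have : 1 - pf m q ^ 2 ≠ 0 := by nlinarith
  unfold Sf
  field_simp

lemma Sf_nonneg (hτ : IsThueMorse τ) (m k : ℕ) {q : ℝ} (hq : 1 < q) : 0 ≤ Sf τ m k q := by
  have h1 := pf_pos m hq
  have h2 := pf_lt_one m hq
  have h3 := Vf_nonneg hτ m hq
  have h4 := Wf_pos hτ m hq
  induction k with
  | zero =>
    unfold Sf
    have : 0 < 1 - pf m q ^ 2 := by nlinarith
    positivity
  | succ k ih => unfold Sf; positivity

lemma sv_sS (hτ : IsThueMorse τ) (m k : ℕ) {q : ℝ} (hq : 1 < q) :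
    seqVal q (fun i => sS τ m k (i + 1)) = Sf τ m k q := by
  induction k with
  | zero =>
    have h := sv_split hq (c := fun i => sS τ m 0 (i + 1)) (fun i => sS_le hτ _ _ _) (2 ^ (m + 1))
    rw [block_V hτ (m + 1) q (fun i => sS τ m 0 (i + 1)) (fun i _ => by simp [sS])] at h
    have e : (fun i => sS τ m 0 (2 ^ (m + 1) + i + 1)) = fun i => sS τ m 0 (i + 1) := by
      ext i; simp [sS, add_assoc]
    rw [e, Vf_succ hτ m hq, pf_succ, show 1 / q ^ 2 ^ (m + 1) = pf m q ^ 2 from pf_succ m q] at h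
    have h1 := pf_pos m hq
    have h2 := pf_lt_one m hq
    have h3 := Sf_zero_eq (τ := τ) m hq
    have h4 : 1 - pf m q ^ 2 ≠ 0 := by nlinarith
    apply mul_right_cancel₀ h4
    rw [h3]
    linarith
  | succ k ih =>
    rw [sv_split hq (c := fun i => sS τ m (k + 1) (i + 1)) (fun i => sS_le hτ _ _ _) (2 ^ m)]
    rw [block_V hτ m q (fun i => sS τ m (k + 1) (i + 1)) (fun i hi => ?_)]
    · have e : (fun i => sS τ m (k + 1) (2 ^ m + i + 1)) = fun i => sS τ m k (i + 1) := by
        ext i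
        unfold sS
        rw [add_mul, one_mul, add_assoc]
        by_cases h : i + 1 < k * 2 ^ m
        · rw [if_pos h, if_pos (by omega), Nat.add_mod_left]
        · rw [if_neg h, if_neg (by omega)]
          congr 3
          omega
      rw [e, ih]
      rfl
    · unfold sS
      rw [add_mul, one_mul]
      by_cases h : i + 1 < k * 2 ^ m + 2 ^ m
      · rw [if_pos h]
      · have : i + 1 = 2 ^ m := by omega
        rw [if_neg h, this, show 2 ^ m - (k * 2 ^ m + 2 ^ m) = 0 by omega]
        simp

lemma sv_dS (hτ : IsThueMorse τ) (m k : ℕ) {q : ℝ} (hq : 1 < q) :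
    seqVal q (fun i => dS τ m k (i + 1)) = Wf τ m q + pf m q * Sf τ m k q := by
  rw [sv_split hq (c := fun i => dS τ m k (i + 1)) (fun i => dS_le hτ _ _ _) (2 ^ m),
    ← sv_sS hτ m k hq]
  congr 1
  · refine Finset.sum_congr rfl fun i hi => ?_
    have hi := Finset.mem_range.1 hi
    congr 2
    unfold dS
    rcases Nat.lt_or_ge (i + 1) (2 ^ m) with h | h
    · rw [if_pos h]
    · have : i + 1 = 2 ^ m := by omega
      rw [if_neg (by omega), this, tm_pow hτ, Nat.sub_self]
      unfold sS
      simp [hτ.1]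
  · unfold pf
    congr 2
    ext i
    unfold dS
    rw [if_neg (by omega)]
    congr 1
    omega

lemma aS_le (hτ : IsThueMorse τ) (m i : ℕ) : aS τ m i ≤ 1 := tm_le hτ _

lemma aS_zero (hτ : IsThueMorse τ) (m : ℕ) : aS τ m 0 = 0 := by
  unfold aS
  rw [Nat.zero_mod, hτ.1]

lemma sv_aS (hτ : IsThueMorse τ) (m : ℕ) {q : ℝ} (hq : 1 < q) (h1 : Wf τ (m + 1) q = 1) :
    seqVal q (fun i => aS τ m (i + 1)) = 1 := by
  have h := sv_split hq (c := fun i => aS τ m (i + 1)) (fun i => tm_le hτ _) (2 ^ (m + 1))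
  have hb := block_W hτ (m + 1) q
  have e : (fun i => aS τ m (2 ^ (m + 1) + i + 1)) = fun i => aS τ m (i + 1) := by
    ext i; simp [aS, add_assoc]
  rw [e, show 1 / q ^ 2 ^ (m + 1) = pf (m + 1) q from rfl] at h
  unfold aS at h ⊢
  rw [hb, h1] at h
  have h2 := pf_lt_one (m + 1) hq
  have h3 : 1 - pf (m + 1) q ≠ 0 := by linarith
  apply mul_right_cancel₀ h3
  linarith

lemma zVal_eq (hτ : IsThueMorse τ) (Q : ℕ → ℝ) (n : ℕ) (hq : 1 < Q (n + 1)) :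
    ∃ F : ℝ, F = Vf τ n (Q (n + 1)) + pf n (Q (n + 1)) + pf n (Q (n + 1)) * F ∧
      zVal τ Q (n + 1) = Wf τ n (Q (n + 1)) + pf n (Q (n + 1)) * F := by
  have hpos : 0 < 2 ^ n := by positivity
  let f : ℕ → ℕ := fun i => τ (2 ^ n + (i % 2 ^ n + 1))
  have hf : ∀ i, f i ≤ 1 := fun i => tm_le hτ _
  refine ⟨seqVal (Q (n + 1)) f, ?_, ?_⟩
  · have h := sv_split hq hf (2 ^ n)
    rw [block_V hτ n _ f (fun i hi => by
      simp only [f]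
      rw [Nat.mod_eq_of_lt hi, tm_block hτ n i hi])] at h
    have e : (fun i => f (2 ^ n + i)) = f := by
      ext i; simp [f]
    rw [e] at h
    exact h
  · unfold zVal
    simp only [Nat.add_sub_cancel]
    set P := prefPeriodic (tmPrefix τ (2 ^ n))
      ((List.range (2 ^ n)).map fun i => τ (2 ^ n + (i + 1))) with hP
    have hlen : (tmPrefix τ (2 ^ n)).length = 2 ^ n := by simp [tmPrefix]
    have hP1 : ∀ i, i < 2 ^ n → P i = τ (i + 1) := by
      intro i hi
      simp [hP, prefPeriodic, hi, tmPrefix]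
    have hP2 : ∀ i, P (2 ^ n + i) = f i := by
      intro i
      have : i % 2 ^ n < 2 ^ n := Nat.mod_lt _ hpos
      simp [hP, prefPeriodic, hlen, f, this]
    have hPle : ∀ i, P i ≤ 1 := by
      intro i
      rcases Nat.lt_or_ge i (2 ^ n) with h | h
      · rw [hP1 i h]; exact tm_le hτ _
      · obtain ⟨j, rfl⟩ := Nat.exists_eq_add_of_le h
        rw [hP2]; exact hf j
    rw [sv_split hq hPle (2 ^ n), funext hP2]
    congr 1
    refine Finset.sum_congr rfl fun i hi => ?_
    rw [hP1 i (Finset.mem_range.1 hi)]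

lemma cont_W (m : ℕ) : ContinuousOn (Wf τ m) (Set.Ioi 1) := by
  unfold Wf
  refine continuousOn_finsetSum _ fun i _ => ?_
  refine ContinuousOn.div continuousOn_const (by fun_prop) fun x hx => ?_
  have hx : 1 < x := hx
  positivity

lemma cont_V (m : ℕ) : ContinuousOn (Vf τ m) (Set.Ioi 1) := by
  unfold Vf
  refine continuousOn_finsetSum _ fun i _ => ?_
  refine ContinuousOn.div continuousOn_const (by fun_prop) fun x hx => ?_
  have hx : 1 < x := hx
  positivity

lemma cont_p (m : ℕ) : ContinuousOn (pf m) (Set.Ioi 1) := by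
  unfold pf
  refine ContinuousOn.div continuousOn_const (by fun_prop) fun x hx => ?_
  have hx : 1 < x := hx
  positivity

lemma cont_S (m k : ℕ) : ContinuousOn (Sf τ m k) (Set.Ioi 1) := by
  induction k with
  | zero =>
    change ContinuousOn (fun q => (Vf τ m q + pf m q * Wf τ m q) / (1 - pf m q ^ 2)) (Set.Ioi 1)
    refine ContinuousOn.div ((cont_V m).add ((cont_p m).mul (cont_W m)))
      (continuousOn_const.sub ((cont_p m).pow 2)) fun x hx => ?_
    have h1 := pf_pos m hx
    have h2 := pf_lt_one m hx
    nlinarith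
  | succ k ih =>
    change ContinuousOn (fun q => Vf τ m q + pf m q + pf m q * Sf τ m k q) (Set.Ioi 1)
    exact ((cont_V m).add (cont_p m)).add ((cont_p m).mul ih)

lemma S_compare (hτ : IsThueMorse τ) (m : ℕ) {κ q : ℝ} (hκ : 1 < κ) (hq : κ ≤ q)
    (h1 : Wf τ (m + 1) κ = 1) (hg : pf m q + pf m q ^ 2 ≤ 1) (k : ℕ) :
    Sf τ m (k + 1) q ≤ Sf τ m k κ + (Vf τ m q + pf m q * Wf τ m q) := by
  have hq1 : 1 < q := by linarith
  have hp := pf_pos m hq1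
  have hp1 := pf_lt_one m hq1
  have hk := pf_pos m hκ
  have hk1 := pf_lt_one m hκ
  have hpk := pf_anti m hκ hq
  have hV := Vf_anti hτ m hκ hq
  have hV0 := Vf_nonneg hτ m hq1
  have hW0 := Wf_pos hτ m hq1
  induction k with
  | zero =>
    have e := Sf_zero_eq (τ := τ) m hq1
    have e1 := Sf_zero_eq (τ := τ) m hκ
    have e2 := Sf_nonneg hτ m 0 hq1
    rw [Wf_succ hτ m hκ] at h1
    have e3 : Sf τ m 0 κ = Vf τ m κ + pf m κ := by
      have h4 : 1 - pf m κ ^ 2 ≠ 0 := by nlinarith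
      apply mul_right_cancel₀ h4
      rw [e1]
      linear_combination pf m κ * h1
    rw [e3, ← e]
    have : Sf τ m (0 + 1) q = Vf τ m q + pf m q + pf m q * Sf τ m 0 q := rfl
    rw [this]
    nlinarith
  | succ k ih =>
    have a1 : Sf τ m (k + 1 + 1) q = Vf τ m q + pf m q + pf m q * Sf τ m (k + 1) q := rfl
    have a2 : Sf τ m (k + 1) κ = Vf τ m κ + pf m κ + pf m κ * Sf τ m k κ := rfl
    have a3 := Sf_nonneg hτ m k hκ
    have a4 : 0 ≤ Vf τ m q + pf m q * Wf τ m q := by positivity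
    rw [a1, a2]
    have b1 := mul_le_mul_of_nonneg_left ih hp.le
    have b2 := mul_le_mul_of_nonneg_right hpk a3
    have b3 := mul_le_mul_of_nonneg_right hp1.le a4
    linarith

end Values

/-- For `n ≥ 2`, `[z_n, z_{n-1}) ⊆ D_n ∩ (1, ∞)`. -/
theorem Ico_subset_D (τ : ℕ → ℕ) (hτ : IsThueMorse τ)
    (Q : ℕ → ℝ) (hQ : IsBaseSeq τ Q) (n : ℕ) (hn : 2 ≤ n) :
    Set.Ico (zVal τ Q n) (zVal τ Q (n - 1)) ⊆ D Q n ∩ Set.Ioi 1 := by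
  obtain ⟨m, rfl⟩ : ∃ m, n = m + 2 := ⟨n - 2, by omega⟩
  rw [show m + 2 - 1 = m + 1 by omega]
  obtain ⟨hκ, -, hκW⟩ := hQ.2 (m + 1) (by omega)
  obtain ⟨hq, -, hqW⟩ := hQ.2 (m + 2) (by omega)
  obtain ⟨F, hF, hz⟩ := zVal_eq hτ Q (m + 1) hq
  obtain ⟨F', hF', hz'⟩ := zVal_eq hτ Q m hκ
  rw [show m + 1 + 1 = m + 2 from rfl] at hF hz
  unfold D
  rw [show m + 2 - 1 = m + 1 by omega, hz, hz']
  have hκW : Wf τ (m + 1) (Q (m + 1)) = 1 := hκW.symm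
  have hqW : Wf τ (m + 2) (Q (m + 2)) = 1 := hqW.symm
  generalize Q (m + 1) = κ at *
  generalize Q (m + 2) = q at *
  clear hz hz'
  have hp := pf_pos m hq
  have hp1 := pf_lt_one m hq
  have hk := pf_pos m hκ
  have hk1 := pf_lt_one m hκ
  have hV0 := Vf_nonneg hτ m hq
  have hW0 := Wf_pos hτ m hq
  have hB : 0 < Vf τ m q + pf m q * Wf τ m q := by positivity
  -- golden ratio bound
  have hgold : 1 / q + 1 / q ^ 2 ≤ 1 := by
    have h0 : (0 : ℝ) < q := by linarith
    have hsub : Finset.range 2 ⊆ Finset.range (2 ^ (m + 2)) :=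
      Finset.range_subset_range.2 (by
        calc 2 = 2 ^ 1 := rfl
          _ ≤ 2 ^ (m + 2) := Nat.pow_le_pow_right (by norm_num) (by omega))
    have := Finset.sum_le_sum_of_subset_of_nonneg
      (f := fun i => (τ (i + 1) : ℝ) / q ^ (i + 1)) hsub (fun i _ _ => by positivity)
    have t2 : τ 2 = 1 := tm_pow hτ 1
    have h3 : 1 / q + 1 / q ^ 2 ≤ Wf τ (m + 2) q := by
      simpa [Finset.sum_range_succ, tm_one hτ, t2, Wf] using this
    linarith
  have hg : pf m q + pf m q ^ 2 ≤ 1 := by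
    have h1 := pf_le m hq
    have h2 : pf m q ^ 2 ≤ (1 / q) ^ 2 := by gcongr
    rw [one_div_pow] at h2
    linarith
  -- key identities at `q`
  have hqW' : Wf τ m q + pf m q * (Vf τ m q + pf m q)
      = 1 - pf m q ^ 2 * (Vf τ m q + pf m q * Wf τ m q) := by
    rw [show m + 2 = (m + 1) + 1 from rfl, Wf_succ hτ (m + 1) hq, Wf_succ hτ m hq,
      Vf_succ hτ m hq, pf_succ] at hqW
    linear_combination hqW
  have hκW' := hκW
  rw [Wf_succ hτ m hκ] at hκW'
  have hlt : κ < q := by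
    by_contra hcon
    push Not at hcon
    have h1 := Wf_anti (τ := τ) (m + 1) hq hcon
    rw [hκW, Wf_succ hτ m hq, hqW'] at h1
    have : 0 < pf m q ^ 2 * (Vf τ m q + pf m q * Wf τ m q) := by positivity
    linarith
  -- `z_n`
  have hE := Sf_zero_eq (τ := τ) m hq
  have hEpos : 0 < Sf τ m 0 q := by
    have h4 : 0 < 1 - pf m q ^ 2 := by nlinarith
    by_contra hcon
    push Not at hcon
    nlinarith
  have hzn : Wf τ (m + 1) q + pf (m + 1) q * F = Wf τ m q + pf m q * Sf τ m 1 q := by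
    rw [Vf_succ hτ m hq, pf_succ] at hF
    have hFE : F = Sf τ m 0 q := by
      have h4 : 1 - pf m q ^ 2 ≠ 0 := by nlinarith
      apply mul_right_cancel₀ h4
      linear_combination hF - hE
    have a1 : Sf τ m 1 q = Vf τ m q + pf m q + pf m q * Sf τ m 0 q := rfl
    rw [hFE, a1, Wf_succ hτ m hq, pf_succ]
    ring
  rw [hzn]
  intro x hx
  obtain ⟨hx1, hx2⟩ := hx
  -- existence of `k`
  have hXk : ∃ k, x < Wf τ m κ + pf m κ * Sf τ m (k + 1) κ := by
    have hS : ∀ k, Sf τ m k κ = F' + pf m κ ^ k * (Sf τ m 0 κ - F') := by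
      intro k
      induction k with
      | zero => simp
      | succ k ih =>
        have a1 : Sf τ m (k + 1) κ = Vf τ m κ + pf m κ + pf m κ * Sf τ m k κ := rfl
        rw [a1, ih, pow_succ]
        linear_combination -hF'
    have ht : Tendsto (fun k : ℕ => Wf τ m κ + pf m κ * Sf τ m (k + 1) κ) atTop
        (𝓝 (Wf τ m κ + pf m κ * (F' + 0 * (Sf τ m 0 κ - F')))) := by
      have hfun : (fun k : ℕ => Wf τ m κ + pf m κ * Sf τ m (k + 1) κ) = fun k : ℕ =>
          Wf τ m κ + pf m κ * (F' + pf m κ ^ (k + 1) * (Sf τ m 0 κ - F')) := by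
        ext k
        rw [hS (k + 1)]
      rw [hfun]
      have := tendsto_pow_atTop_nhds_zero_of_lt_one hk.le hk1
      have := this.comp (tendsto_add_atTop_nat 1)
      exact (((this.mul_const _).const_add _).const_mul _).const_add _
    rw [zero_mul, add_zero] at ht
    exact (ht.eventually (lt_mem_nhds hx2)).exists
  -- find a good `k`
  have hgood : ∃ k, Wf τ m q + pf m q * Sf τ m (k + 1) q ≤ x ∧
      x < Wf τ m κ + pf m κ * Sf τ m (k + 1) κ := by
    classical
    refine ⟨Nat.find hXk, ?_, Nat.find_spec hXk⟩
    rcases hk0 : Nat.find hXk with _ | k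
    · exact hx1
    · have hmin := Nat.find_min hXk (m := k) (by omega)
      push Not at hmin
      refine le_trans ?_ hmin
      have hc := S_compare hτ m hκ hlt.le hκW hg k
      have a1 : Sf τ m (k + 1 + 1) q = Vf τ m q + pf m q + pf m q * Sf τ m (k + 1) q := rfl
      have a2 : Sf τ m (k + 1) κ = Vf τ m κ + pf m κ + pf m κ * Sf τ m k κ := rfl
      have a3 := Sf_nonneg hτ m k hκ
      have b1 := mul_le_mul_of_nonneg_left hc (by positivity : 0 ≤ pf m q ^ 2)
      have hpk : pf m q ^ 2 ≤ pf m κ ^ 2 := by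
        have := pf_anti m hκ hlt.le
        gcongr
      have b2 := mul_le_mul_of_nonneg_right hpk a3
      rw [a1, a2]
      linarith
  obtain ⟨k, hk2, hk3⟩ := hgood
  refine ⟨?_, ?_⟩
  · have hcont : ContinuousOn (fun r => Wf τ m r + pf m r * Sf τ m (k + 1) r) (Set.Icc κ q) :=
      ((cont_W m).add ((cont_p m).mul (cont_S m (k + 1)))).mono
        fun y hy => lt_of_lt_of_le hκ hy.1
    obtain ⟨r, hr, hrx⟩ := intermediate_value_Icc' hlt.le hcont ⟨hk2, hk3.le⟩
    simp only at hrx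
    have hrκ : κ < r := by
      rcases hr.1.lt_or_eq with h | h
      · exact h
      · rw [← h] at hrx
        exact absurd hrx hk3.ne'
    have hr1 : 1 < r := hκ.trans hrκ
    rw [← sv_dS hτ m (k + 1) hr1] at hrx
    simp only [Set.mem_iUnion]
    refine ⟨r, ⟨hrκ, hr.2⟩, ?_, ?_⟩
    · rw [← hrx]
      exact ⟨sv_nonneg hr1 _, sv_le hr1 (fun i => dS_le hτ _ _ _)⟩
    · refine ⟨fun i => dS τ m (k + 1) (i + 1), ⟨fun i => dS_le hτ _ _ _, hrx.symm⟩, ?_⟩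
      rw [← hrx]
      exact star_unique hκ hrκ (aS_le hτ m) (aS_zero hτ m) (sv_aS hτ m hκ hκW)
        (dS_le hτ m (k + 1)) (star_dS hτ m (k + 1))
  · refine lt_of_lt_of_le ?_ hx1
    have a1 : Sf τ m 1 q = Vf τ m q + pf m q + pf m q * Sf τ m 0 q := rfl
    rw [a1]
    have : 0 < pf m q ^ 4 * Sf τ m 0 q := by positivity
    have h5 : Wf τ m q + pf m q * (Vf τ m q + pf m q + pf m q * Sf τ m 0 q)
        = 1 + pf m q ^ 4 * Sf τ m 0 q := by
      linear_combination hqW' + pf m q ^ 2 * hE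
    linarith
end
end
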